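/- (Twisting Map Extension Problem) Let t: (B⊗A)_{≤n} → (A⊗B)_{≤n} be a 𝕜-linear map that is graded twisting to degree n. There exists a 𝕜-linear extension t': (B⊗A)_{≤n+1} → (A⊗B)_{≤n+1} of t that is graded twisting to degree n+1 if and only if there exists a 𝕜-linear map f: (B₊⊗A₊)_{n+1} → (A⊗B)_{n+1} satisfying f∘δ_{n+1} = R_{n+1}. Moreover, if such an extension t' exists, it is unique if and only if δ_{n+1} is surjective. -/

import Mathlib

open TensorProduct

noncomputable section

namespace TTP

variable (𝕜 : Type) [Field 𝕜]

/-- The image of `p ⊗ q` inside `M ⊗[𝕜] N`, for submodules `p ⊆ M`, `q ⊆ N`. -/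
def subTmul {M N : Type} [AddCommGroup M] [Module 𝕜 M] [AddCommGroup N] [Module 𝕜 N]
    (p : Submodule 𝕜 M) (q : Submodule 𝕜 N) : Submodule 𝕜 (M ⊗[𝕜] N) :=
  LinearMap.range (TensorProduct.map p.subtype q.subtype)

/-- The Künneth grading on a tensor product of graded vector spaces. -/
def kunneth {M N : Type} [AddCommGroup M] [Module 𝕜 M] [AddCommGroup N] [Module 𝕜 N]
    (𝒜 : ℕ → Submodule 𝕜 M) (ℬ : ℕ → Submodule 𝕜 N) (n : ℕ) : Submodule 𝕜 (M ⊗[𝕜] N) :=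
  ⨆ (pq : ℕ × ℕ) (_ : pq.1 + pq.2 = n), subTmul 𝕜 (𝒜 pq.1) (ℬ pq.2)

/-- The positive part `X₊ = ⊕_{i>0} X_i` of a graded vector space. -/
def plusPart {M : Type} [AddCommGroup M] [Module 𝕜 M] (𝒜 : ℕ → Submodule 𝕜 M) :
    Submodule 𝕜 M :=
  ⨆ (i : ℕ) (_ : 0 < i), 𝒜 i

/-- The grading concentrating `𝒜 1` in degree `1` (and `⊥` elsewhere). -/
def degOne {M : Type} [AddCommGroup M] [Module 𝕜 M] (𝒜 : ℕ → Submodule 𝕜 M) :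
    ℕ → Submodule 𝕜 M :=
  fun n => if n = 1 then 𝒜 1 else ⊥

variable (A B : Type) [Ring A] [Algebra 𝕜 A] [Ring B] [Algebra 𝕜 B]

/-- `τ ∘ (μ_B ⊗ μ_A)` on `(B ⊗ B) ⊗ (A ⊗ A)`. -/
def twistLHS (τ : B ⊗[𝕜] A →ₗ[𝕜] A ⊗[𝕜] B) :
    (B ⊗[𝕜] B) ⊗[𝕜] (A ⊗[𝕜] A) →ₗ[𝕜] A ⊗[𝕜] B :=
  τ ∘ₗ TensorProduct.map (LinearMap.mul' 𝕜 B) (LinearMap.mul' 𝕜 A)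

/-- `(μ_A ⊗ μ_B) ∘ (1_A ⊗ τ ⊗ 1_B) ∘ (τ ⊗ τ) ∘ (1_B ⊗ τ ⊗ 1_A)` on `(B ⊗ B) ⊗ (A ⊗ A)`. -/
def twistRHS (τ : B ⊗[𝕜] A →ₗ[𝕜] A ⊗[𝕜] B) :
    (B ⊗[𝕜] B) ⊗[𝕜] (A ⊗[𝕜] A) →ₗ[𝕜] A ⊗[𝕜] B :=
  TensorProduct.map (LinearMap.mul' 𝕜 A) (LinearMap.mul' 𝕜 B)
    ∘ₗ (TensorProduct.assoc 𝕜 A A (B ⊗[𝕜] B)).symm.toLinearMap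
    ∘ₗ LinearMap.lTensor A (TensorProduct.assoc 𝕜 A B B).toLinearMap
    ∘ₗ LinearMap.lTensor A (LinearMap.rTensor B τ)
    ∘ₗ LinearMap.lTensor A (TensorProduct.assoc 𝕜 B A B).symm.toLinearMap
    ∘ₗ (TensorProduct.assoc 𝕜 A B (A ⊗[𝕜] B)).toLinearMap
    ∘ₗ TensorProduct.map τ τ
    ∘ₗ (TensorProduct.assoc 𝕜 B A (B ⊗[𝕜] A)).symm.toLinearMap
    ∘ₗ LinearMap.lTensor B (TensorProduct.assoc 𝕜 A B A).toLinearMap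
    ∘ₗ LinearMap.lTensor B (LinearMap.rTensor A τ)
    ∘ₗ LinearMap.lTensor B (TensorProduct.assoc 𝕜 B A A).symm.toLinearMap
    ∘ₗ (TensorProduct.assoc 𝕜 B B (A ⊗[𝕜] A)).toLinearMap

/-- `τ : B ⊗ A → A ⊗ B` is an (algebra) twisting map: it satisfies the unital twisting
conditions and `τ(μ_B ⊗ μ_A) = (μ_A ⊗ μ_B)(1_A ⊗ τ ⊗ 1_B)(τ ⊗ τ)(1_B ⊗ τ ⊗ 1_A)`. -/
def IsTwisting (τ : B ⊗[𝕜] A →ₗ[𝕜] A ⊗[𝕜] B) : Prop :=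
  (∀ a : A, τ ((1 : B) ⊗ₜ[𝕜] a) = a ⊗ₜ[𝕜] (1 : B)) ∧
  (∀ b : B, τ (b ⊗ₜ[𝕜] (1 : A)) = (1 : A) ⊗ₜ[𝕜] b) ∧
  twistLHS 𝕜 A B τ = twistRHS 𝕜 A B τ

/-- `τ` preserves the Künneth grading. -/
def IsGradedMapBA (𝒜 : ℕ → Submodule 𝕜 A) (ℬ : ℕ → Submodule 𝕜 B)
    (τ : B ⊗[𝕜] A →ₗ[𝕜] A ⊗[𝕜] B) : Prop :=
  ∀ n, Submodule.map τ (kunneth 𝕜 ℬ 𝒜 n) ≤ kunneth 𝕜 𝒜 ℬ n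

/-- `τ` is a graded twisting map. -/
def IsGradedTwisting (𝒜 : ℕ → Submodule 𝕜 A) (ℬ : ℕ → Submodule 𝕜 B)
    (τ : B ⊗[𝕜] A →ₗ[𝕜] A ⊗[𝕜] B) : Prop :=
  IsTwisting 𝕜 A B τ ∧ IsGradedMapBA 𝕜 A B 𝒜 ℬ τ

/-- A graded linear map `τ` is graded twisting to degree `n`:  it satisfies the unital
conditions and the twisting identity in all (Künneth) degrees `≤ n`. -/
def TwistingToDeg (𝒜 : ℕ → Submodule 𝕜 A) (ℬ : ℕ → Submodule 𝕜 B)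
    (τ : B ⊗[𝕜] A →ₗ[𝕜] A ⊗[𝕜] B) (n : ℕ) : Prop :=
  IsGradedMapBA 𝕜 A B 𝒜 ℬ τ ∧
  (∀ j ≤ n, ∀ a ∈ 𝒜 j, τ ((1 : B) ⊗ₜ[𝕜] a) = a ⊗ₜ[𝕜] (1 : B)) ∧
  (∀ j ≤ n, ∀ b ∈ ℬ j, τ (b ⊗ₜ[𝕜] (1 : A)) = (1 : A) ⊗ₜ[𝕜] b) ∧
  (∀ j ≤ n, ∀ x ∈ kunneth 𝕜 (kunneth 𝕜 ℬ ℬ) (kunneth 𝕜 𝒜 𝒜) j,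
    twistLHS 𝕜 A B τ x = twistRHS 𝕜 A B τ x)

/-- The unique extension property of a graded twisting map:  for every `n ≥ 3`, any
linear map `τ'` that is graded twisting to degree `n` and agrees with `τ` in all degrees
`< n` also agrees with `τ` in degree `n`. -/
def UEP (𝒜 : ℕ → Submodule 𝕜 A) (ℬ : ℕ → Submodule 𝕜 B)
    (τ : B ⊗[𝕜] A →ₗ[𝕜] A ⊗[𝕜] B) : Prop :=
  ∀ n, 3 ≤ n → ∀ τ' : B ⊗[𝕜] A →ₗ[𝕜] A ⊗[𝕜] B,
    TwistingToDeg 𝕜 A B 𝒜 ℬ τ' n →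
    (∀ i < n, ∀ x ∈ kunneth 𝕜 ℬ 𝒜 i, τ' x = τ x) →
    ∀ x ∈ kunneth 𝕜 ℬ 𝒜 n, τ' x = τ x

/-- The multiplication `μ_τ = (μ_A ⊗ μ_B)(1_A ⊗ τ ⊗ 1_B)` on `A ⊗ B`. -/
def mulTau (τ : B ⊗[𝕜] A →ₗ[𝕜] A ⊗[𝕜] B) :
    (A ⊗[𝕜] B) ⊗[𝕜] (A ⊗[𝕜] B) →ₗ[𝕜] A ⊗[𝕜] B :=
  TensorProduct.map (LinearMap.mul' 𝕜 A) (LinearMap.mul' 𝕜 B)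
    ∘ₗ (TensorProduct.assoc 𝕜 A A (B ⊗[𝕜] B)).symm.toLinearMap
    ∘ₗ LinearMap.lTensor A (TensorProduct.assoc 𝕜 A B B).toLinearMap
    ∘ₗ LinearMap.lTensor A (LinearMap.rTensor B τ)
    ∘ₗ LinearMap.lTensor A (TensorProduct.assoc 𝕜 B A B).symm.toLinearMap
    ∘ₗ (TensorProduct.assoc 𝕜 A B (A ⊗[𝕜] B)).toLinearMap

/-- `(C, ψ)` realizes the twisted tensor product algebra `A ⊗_τ B`:  `ψ` is a linear
isomorphism carrying the multiplication `μ_τ` and its unit to those of `C`. -/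
def Realizes (τ : B ⊗[𝕜] A →ₗ[𝕜] A ⊗[𝕜] B) (C : Type) [Ring C] [Algebra 𝕜 C]
    (ψ : A ⊗[𝕜] B →ₗ[𝕜] C) : Prop :=
  Function.Bijective ψ ∧ ψ ((1 : A) ⊗ₜ[𝕜] (1 : B)) = 1 ∧
  ∀ x y : A ⊗[𝕜] B, ψ (mulTau 𝕜 A B τ (x ⊗ₜ[𝕜] y)) = ψ x * ψ y

/-- The two-sided ideal generated by a subset, as a `𝕜`-submodule. -/
def idealSpan (C : Type) [Ring C] [Algebra 𝕜 C] (s : Set C) : Submodule 𝕜 C :=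
  Submodule.span 𝕜 {x | ∃ c d r, r ∈ s ∧ x = c * r * d}

/-- Weight grading of the tensor algebra. -/
def tensorWeight (V : Type) [AddCommGroup V] [Module 𝕜 V] (n : ℕ) :
    Submodule 𝕜 (TensorAlgebra 𝕜 V) :=
  LinearMap.range (TensorAlgebra.ι 𝕜 (M := V)) ^ n

instance (V : Type) [AddCommGroup V] [Module 𝕜 V] : GradedAlgebra (tensorWeight 𝕜 V) :=
  inferInstanceAs (GradedAlgebra
    ((LinearMap.range (TensorAlgebra.ι 𝕜 : V →ₗ[𝕜] TensorAlgebra 𝕜 V) ^ ·) : ℕ → Submodule 𝕜 _))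

/-- The canonical map `T(C₁) → C` for a graded algebra `C`. -/
def canMap (C : Type) [Ring C] [Algebra 𝕜 C] (𝒞 : ℕ → Submodule 𝕜 C) :
    TensorAlgebra 𝕜 ↥(𝒞 1) →ₐ[𝕜] C :=
  TensorAlgebra.lift 𝕜 (𝒞 1).subtype

/-- `C` (with grading `𝒞`) is a quadratic algebra: the canonical map `T(C₁) → C` is
surjective and its kernel is generated, as a two-sided ideal, by its degree 2 part. -/
def IsQuadraticAlg (C : Type) [Ring C] [Algebra 𝕜 C] (𝒞 : ℕ → Submodule 𝕜 C) : Prop :=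
  Function.Surjective (canMap 𝕜 C 𝒞) ∧
  LinearMap.ker (canMap 𝕜 C 𝒞).toLinearMap =
    idealSpan 𝕜 (TensorAlgebra 𝕜 ↥(𝒞 1))
      ((LinearMap.ker (canMap 𝕜 C 𝒞).toLinearMap ⊓ tensorWeight 𝕜 ↥(𝒞 1) 2 : Submodule 𝕜 _) : Set _)

/-- The left ideal generated by the positive part of a graded algebra. -/
def augIdeal (C : Type) [Ring C] [Algebra 𝕜 C] (𝒞 : ℕ → Submodule 𝕜 C) : Submodule C C :=
  Submodule.span C {x : C | ∃ i, 0 < i ∧ x ∈ 𝒞 i}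

/-- The degree `n` component of the graded free module on generators `σ` in degree `i`. -/
def freeGrade (C : Type) [Ring C] [Algebra 𝕜 C] (𝒞 : ℕ → Submodule 𝕜 C)
    (i : ℕ) (σ : Type) (n : ℕ) : Submodule 𝕜 (σ →₀ C) :=
  ⨅ (j : σ), Submodule.comap (Finsupp.lapply j : (σ →₀ C) →ₗ[𝕜] C)
    (if i ≤ n then 𝒞 (n - i) else ⊥)

/-- `C` (with grading `𝒞`) is a Koszul algebra: the trivial module `𝕜 = C/C₊` admits a
resolution by graded free modules with the `i`-th term generated in degree `i`. -/
def IsKoszul (C : Type) [Ring C] [Algebra 𝕜 C] (𝒞 : ℕ → Submodule 𝕜 C) : Prop :=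
  ∃ (σ : ℕ → Type) (d : ∀ i : ℕ, ((σ (i + 1)) →₀ C) →ₗ[C] ((σ i) →₀ C))
    (ε : ((σ 0) →₀ C) →ₗ[C] (C ⧸ augIdeal 𝕜 C 𝒞)),
    Function.Surjective ε ∧
    LinearMap.ker ε = LinearMap.range (d 0) ∧
    (∀ i, LinearMap.ker (d i) = LinearMap.range (d (i + 1))) ∧
    (∀ i n, ∀ x ∈ freeGrade 𝕜 C 𝒞 (i + 1) (σ (i + 1)) n, d i x ∈ freeGrade 𝕜 C 𝒞 i (σ i) n) ∧
    (∀ n, 0 < n → ∀ x ∈ freeGrade 𝕜 C 𝒞 0 (σ 0) n, ε x = 0)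

/-- `(P, ιA, ιB)` is a free product (coproduct) of `A` and `B`. -/
def IsFreeProduct (P : Type) [Ring P] [Algebra 𝕜 P] (ιA : A →ₐ[𝕜] P) (ιB : B →ₐ[𝕜] P) :
    Prop :=
  ∀ (C : Type) [Ring C] [Algebra 𝕜 C], ∀ (f : A →ₐ[𝕜] C) (g : B →ₐ[𝕜] C),
    ∃! h : P →ₐ[𝕜] C, h.comp ιA = f ∧ h.comp ιB = g

/-- The linear map `A ⊗ B → P`, `a ⊗ b ↦ ιA(a) · ιB(b)`. -/
def mulMapP (P : Type) [Ring P] [Algebra 𝕜 P] (ιA : A →ₐ[𝕜] P) (ιB : B →ₐ[𝕜] P) :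
    A ⊗[𝕜] B →ₗ[𝕜] P :=
  TensorProduct.lift (LinearMap.mk₂ 𝕜 (fun a b => ιA a * ιB b)
    (fun a a' b => by simp [map_add, add_mul])
    (fun c a b => by simp [map_smul, smul_mul_assoc])
    (fun a b b' => by simp [map_add, mul_add])
    (fun c a b => by simp [map_smul, mul_smul_comm]))

/-- The set of `τ`-relations `b ⊗ a - τ(b ⊗ a)` of total degree at most `n`,
inside the free product `P`. -/
def relSetLe (P : Type) [Ring P] [Algebra 𝕜 P] (ιA : A →ₐ[𝕜] P) (ιB : B →ₐ[𝕜] P)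
    (𝒜 : ℕ → Submodule 𝕜 A) (ℬ : ℕ → Submodule 𝕜 B)
    (τ : B ⊗[𝕜] A →ₗ[𝕜] A ⊗[𝕜] B) (n : ℕ) : Set P :=
  {x | ∃ i j a b, i + j ≤ n ∧ a ∈ 𝒜 i ∧ b ∈ ℬ j ∧
    x = ιB b * ιA a - mulMapP 𝕜 A B P ιA ιB (τ (b ⊗ₜ[𝕜] a))}

/-- The set of all `τ`-relations `b ⊗ a - τ(b ⊗ a)` inside the free product `P`. -/
def relSetAll (P : Type) [Ring P] [Algebra 𝕜 P] (ιA : A →ₐ[𝕜] P) (ιB : B →ₐ[𝕜] P)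
    (τ : B ⊗[𝕜] A →ₗ[𝕜] A ⊗[𝕜] B) : Set P :=
  {x | ∃ a b, x = ιB b * ιA a - mulMapP 𝕜 A B P ιA ιB (τ (b ⊗ₜ[𝕜] a))}

/-- The (Künneth) grading on the free product `P` of the graded algebras `A` and `B`. -/
def freeProdGrade (P : Type) [Ring P] [Algebra 𝕜 P] (ιA : A →ₐ[𝕜] P) (ιB : B →ₐ[𝕜] P)
    (𝒜 : ℕ → Submodule 𝕜 A) (ℬ : ℕ → Submodule 𝕜 B) (n : ℕ) : Submodule 𝕜 P :=
  ⨆ (l : List ℕ) (_ : l.sum = n),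
    ((l.map (fun i => Submodule.map ιA.toLinearMap (𝒜 i) ⊔ Submodule.map ιB.toLinearMap (ℬ i))).foldr
      (· * ·) 1)

end TTP

namespace TTP

open TensorProduct LinearMap

variable (𝕜 : Type) [Field 𝕜] (A B : Type) [Ring A] [Algebra 𝕜 A] [Ring B] [Algebra 𝕜 B]

/-- `t^B = π^B ∘ t : B ⊗ A → B`, using the augmentation `ε_A` of the connected graded
algebra `A`. -/
def tBmap (εA : A →ₗ[𝕜] 𝕜) (t : B ⊗[𝕜] A →ₗ[𝕜] A ⊗[𝕜] B) : B ⊗[𝕜] A →ₗ[𝕜] B :=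
  (TensorProduct.lid 𝕜 B).toLinearMap ∘ₗ TensorProduct.map εA LinearMap.id ∘ₗ t

/-- `t^A = π^A ∘ t : B ⊗ A → A`, using the augmentation `ε_B` of the connected graded
algebra `B`. -/
def tAmap (εB : B →ₗ[𝕜] 𝕜) (t : B ⊗[𝕜] A →ₗ[𝕜] A ⊗[𝕜] B) : B ⊗[𝕜] A →ₗ[𝕜] A :=
  (TensorProduct.rid 𝕜 A).toLinearMap ∘ₗ TensorProduct.map LinearMap.id εB ∘ₗ t

/-- The first component `1_B ⊗ μ_A - t^B ⊗ 1_A` of the map `δ`, on `B ⊗ A ⊗ A`. -/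
def delta1 (εA : A →ₗ[𝕜] 𝕜) (t : B ⊗[𝕜] A →ₗ[𝕜] A ⊗[𝕜] B) :
    (B ⊗[𝕜] A) ⊗[𝕜] A →ₗ[𝕜] B ⊗[𝕜] A :=
  lTensor B (mul' 𝕜 A) ∘ₗ (TensorProduct.assoc 𝕜 B A A).toLinearMap -
    rTensor A (tBmap 𝕜 A B εA t)

/-- The second component `μ_B ⊗ 1_A - 1_B ⊗ t^A` of the map `δ`, on `B ⊗ B ⊗ A`. -/
def delta2 (εB : B →ₗ[𝕜] 𝕜) (t : B ⊗[𝕜] A →ₗ[𝕜] A ⊗[𝕜] B) :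
    B ⊗[𝕜] (B ⊗[𝕜] A) →ₗ[𝕜] B ⊗[𝕜] A :=
  rTensor A (mul' 𝕜 B) ∘ₗ (TensorProduct.assoc 𝕜 B B A).symm.toLinearMap -
    lTensor B (tAmap 𝕜 A B εB t)

/-- The first component `(μ_A ⊗ 1_B)(1_A ⊗ t)((t - i_B t^B) ⊗ 1_A)` of the map `R`. -/
def Rmap1 (εA : A →ₗ[𝕜] 𝕜) (t : B ⊗[𝕜] A →ₗ[𝕜] A ⊗[𝕜] B) :
    (B ⊗[𝕜] A) ⊗[𝕜] A →ₗ[𝕜] A ⊗[𝕜] B :=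
  rTensor B (mul' 𝕜 A) ∘ₗ (TensorProduct.assoc 𝕜 A A B).symm.toLinearMap
    ∘ₗ lTensor A t ∘ₗ (TensorProduct.assoc 𝕜 A B A).toLinearMap
    ∘ₗ rTensor A (t - (TensorProduct.mk 𝕜 A B 1) ∘ₗ tBmap 𝕜 A B εA t)

/-- The second component `(1_A ⊗ μ_B)(t ⊗ 1_B)(1_B ⊗ (t - i_A t^A))` of the map `R`. -/
def Rmap2 (εB : B →ₗ[𝕜] 𝕜) (t : B ⊗[𝕜] A →ₗ[𝕜] A ⊗[𝕜] B) :
    B ⊗[𝕜] (B ⊗[𝕜] A) →ₗ[𝕜] A ⊗[𝕜] B :=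
  lTensor A (mul' 𝕜 B) ∘ₗ (TensorProduct.assoc 𝕜 A B B).toLinearMap
    ∘ₗ rTensor B t ∘ₗ (TensorProduct.assoc 𝕜 B A B).symm.toLinearMap
    ∘ₗ lTensor B (t - ((TensorProduct.mk 𝕜 A B).flip 1) ∘ₗ tAmap 𝕜 A B εB t)

/-- The positive-degree part of a grading (`⊥` in degree `0`). -/
def posF {M : Type} [AddCommGroup M] [Module 𝕜 M] (𝒜 : ℕ → Submodule 𝕜 M) :
    ℕ → Submodule 𝕜 M :=
  fun i => if i = 0 then ⊥ else 𝒜 i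

/-- `t'` is an extension of `t` (in degrees `≤ n`) which is graded twisting to
degree `n + 1`. -/
def ExtCond (𝒜 : ℕ → Submodule 𝕜 A) (ℬ : ℕ → Submodule 𝕜 B)
    (t t' : B ⊗[𝕜] A →ₗ[𝕜] A ⊗[𝕜] B) (n : ℕ) : Prop :=
  TwistingToDeg 𝕜 A B 𝒜 ℬ t' (n + 1) ∧
  ∀ i ≤ n, ∀ x ∈ kunneth 𝕜 ℬ 𝒜 i, t' x = t x

section Kunneth

variable {𝕜} {M N P : Type} [AddCommGroup M] [Module 𝕜 M] [AddCommGroup N] [Module 𝕜 N]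
  [AddCommGroup P] [Module 𝕜 P]

lemma tmul_mem_kunneth {𝒜 : ℕ → Submodule 𝕜 M} {ℬ : ℕ → Submodule 𝕜 N} {i j n : ℕ} {a : M}
    {b : N} (ha : a ∈ 𝒜 i) (hb : b ∈ ℬ j) (h : i + j = n) : a ⊗ₜ[𝕜] b ∈ kunneth 𝕜 𝒜 ℬ n :=
  Submodule.mem_iSup_of_mem (i, j) <| Submodule.mem_iSup_of_mem h
    ⟨(⟨a, ha⟩ : 𝒜 i) ⊗ₜ[𝕜] (⟨b, hb⟩ : ℬ j), by simp⟩

lemma kunneth_le {𝒜 : ℕ → Submodule 𝕜 M} {ℬ : ℕ → Submodule 𝕜 N} {n : ℕ}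
    {S : Submodule 𝕜 (M ⊗[𝕜] N)}
    (h : ∀ i j, i + j = n → ∀ a ∈ 𝒜 i, ∀ b ∈ ℬ j, a ⊗ₜ[𝕜] b ∈ S) : kunneth 𝕜 𝒜 ℬ n ≤ S := by
  refine iSup₂_le fun pq hpq => ?_
  rintro _ ⟨x, rfl⟩
  induction x using TensorProduct.induction_on with
  | zero => simp
  | tmul a b => exact h _ _ hpq _ a.2 _ b.2
  | add x y hx hy => rw [map_add]; exact S.add_mem hx hy

lemma kunneth_eqOn {𝒜 : ℕ → Submodule 𝕜 M} {ℬ : ℕ → Submodule 𝕜 N} {n : ℕ}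
    {f g : M ⊗[𝕜] N →ₗ[𝕜] P}
    (h : ∀ i j, i + j = n → ∀ a ∈ 𝒜 i, ∀ b ∈ ℬ j, f (a ⊗ₜ[𝕜] b) = g (a ⊗ₜ[𝕜] b))
    {x : M ⊗[𝕜] N} (hx : x ∈ kunneth 𝕜 𝒜 ℬ n) : f x = g x :=
  kunneth_le (S := LinearMap.eqLocus f g) h hx

lemma posF_le (𝒜 : ℕ → Submodule 𝕜 M) (i : ℕ) : posF 𝕜 𝒜 i ≤ 𝒜 i := by
  unfold posF
  split_ifs <;> simp

lemma mem_posF {𝒜 : ℕ → Submodule 𝕜 M} {i : ℕ} (hi : i ≠ 0) {a : M} :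
    a ∈ posF 𝕜 𝒜 i ↔ a ∈ 𝒜 i := by
  simp [posF, hi]

lemma posF_cases {𝒜 : ℕ → Submodule 𝕜 M} {i : ℕ} {a : M} (ha : a ∈ posF 𝕜 𝒜 i) :
    a = 0 ∨ (i ≠ 0 ∧ a ∈ 𝒜 i) := by
  by_cases hi : i = 0
  · left; simpa [posF, hi] using ha
  · exact Or.inr ⟨hi, (mem_posF hi).1 ha⟩

lemma kunneth_mono {𝒜 𝒜' : ℕ → Submodule 𝕜 M} {ℬ ℬ' : ℕ → Submodule 𝕜 N}
    (h : ∀ i, 𝒜 i ≤ 𝒜' i) (h' : ∀ i, ℬ i ≤ ℬ' i) (n : ℕ) :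
    kunneth 𝕜 𝒜 ℬ n ≤ kunneth 𝕜 𝒜' ℬ' n :=
  kunneth_le fun _ _ hij _ ha _ hb => tmul_mem_kunneth (h _ ha) (h' _ hb) hij

/-- Elements of the Künneth grading minus their part over degree zero, on the left. -/
lemma sub_mem_kunneth_posF_left {𝒜 : ℕ → Submodule 𝕜 M} {ℬ : ℕ → Submodule 𝕜 N}
    {e : M} {ε : M →ₗ[𝕜] 𝕜} (h0 : ∀ x ∈ 𝒜 0, ε x • e = x)
    (hp : ∀ j, 0 < j → ∀ x ∈ 𝒜 j, ε x = 0) {m : ℕ} {x : M ⊗[𝕜] N}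
    (hx : x ∈ kunneth 𝕜 𝒜 ℬ m) :
    x - e ⊗ₜ[𝕜] TensorProduct.lid 𝕜 N (TensorProduct.map ε LinearMap.id x) ∈
      kunneth 𝕜 (posF 𝕜 𝒜) ℬ m := by
  refine kunneth_le (S := Submodule.comap (LinearMap.id - TensorProduct.mk 𝕜 M N e ∘ₗ
    (TensorProduct.lid 𝕜 N).toLinearMap ∘ₗ TensorProduct.map ε LinearMap.id)
    (kunneth 𝕜 (posF 𝕜 𝒜) ℬ m)) (fun i j hij a ha b hb => ?_) hx
  rcases Nat.eq_zero_or_pos i with rfl | hi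
  · simp [TensorProduct.smul_tmul', h0 a ha]
  · simpa [hp i hi a ha] using tmul_mem_kunneth ((mem_posF hi.ne').2 ha) hb hij

/-- Elements of the Künneth grading minus their part over degree zero, on the right. -/
lemma sub_mem_kunneth_posF_right {𝒜 : ℕ → Submodule 𝕜 M} {ℬ : ℕ → Submodule 𝕜 N}
    {e : N} {ε : N →ₗ[𝕜] 𝕜} (h0 : ∀ x ∈ ℬ 0, ε x • e = x)
    (hp : ∀ j, 0 < j → ∀ x ∈ ℬ j, ε x = 0) {m : ℕ} {x : M ⊗[𝕜] N}
    (hx : x ∈ kunneth 𝕜 𝒜 ℬ m) :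
    x - TensorProduct.rid 𝕜 M (TensorProduct.map LinearMap.id ε x) ⊗ₜ[𝕜] e ∈
      kunneth 𝕜 𝒜 (posF 𝕜 ℬ) m := by
  refine kunneth_le (S := Submodule.comap (LinearMap.id - (TensorProduct.mk 𝕜 M N).flip e ∘ₗ
    (TensorProduct.rid 𝕜 M).toLinearMap ∘ₗ TensorProduct.map LinearMap.id ε)
    (kunneth 𝕜 𝒜 (posF 𝕜 ℬ) m)) (fun i j hij a ha b hb => ?_) hx
  rcases Nat.eq_zero_or_pos j with rfl | hj
  · simp [← TensorProduct.tmul_smul, h0 b hb]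
  · simpa [hp j hj b hb] using tmul_mem_kunneth ha ((mem_posF hj.ne').2 hb) hij

lemma lid_map_mem {𝒜 : ℕ → Submodule 𝕜 M} {ℬ : ℕ → Submodule 𝕜 N} {ε : M →ₗ[𝕜] 𝕜}
    (hp : ∀ j, 0 < j → ∀ x ∈ 𝒜 j, ε x = 0) {m : ℕ} {x : M ⊗[𝕜] N}
    (hx : x ∈ kunneth 𝕜 𝒜 ℬ m) :
    TensorProduct.lid 𝕜 N (TensorProduct.map ε LinearMap.id x) ∈ ℬ m := by
  refine kunneth_le (S := Submodule.comap ((TensorProduct.lid 𝕜 N).toLinearMap ∘ₗ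
    TensorProduct.map ε LinearMap.id) (ℬ m)) (fun i j hij a ha b hb => ?_) hx
  rcases Nat.eq_zero_or_pos i with rfl | hi
  · obtain rfl : j = m := by omega
    simpa using (ℬ j).smul_mem _ hb
  · simp [hp i hi a ha]

lemma rid_map_mem {𝒜 : ℕ → Submodule 𝕜 M} {ℬ : ℕ → Submodule 𝕜 N} {ε : N →ₗ[𝕜] 𝕜}
    (hp : ∀ j, 0 < j → ∀ x ∈ ℬ j, ε x = 0) {m : ℕ} {x : M ⊗[𝕜] N}
    (hx : x ∈ kunneth 𝕜 𝒜 ℬ m) :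
    TensorProduct.rid 𝕜 M (TensorProduct.map LinearMap.id ε x) ∈ 𝒜 m := by
  refine kunneth_le (S := Submodule.comap ((TensorProduct.rid 𝕜 M).toLinearMap ∘ₗ
    TensorProduct.map LinearMap.id ε) (𝒜 m)) (fun i j hij a ha b hb => ?_) hx
  rcases Nat.eq_zero_or_pos j with rfl | hj
  · obtain rfl : i = m := by omega
    simpa using (𝒜 i).smul_mem _ ha
  · simp [hp j hj b hb]

lemma kunneth_posF_left_eqOn {Q : Type} [AddCommGroup Q] [Module 𝕜 Q] {𝒜 : ℕ → Submodule 𝕜 M}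
    {ℬ : ℕ → Submodule 𝕜 N} {𝒞 : ℕ → Submodule 𝕜 P} {n : ℕ} {f g : (M ⊗[𝕜] N) ⊗[𝕜] P →ₗ[𝕜] Q}
    (h : ∀ i j k, i ≠ 0 → j ≠ 0 → k ≠ 0 → i + j + k = n → ∀ a ∈ 𝒜 i, ∀ b ∈ ℬ j, ∀ c ∈ 𝒞 k,
      f ((a ⊗ₜ b) ⊗ₜ c) = g ((a ⊗ₜ b) ⊗ₜ c)) {x : (M ⊗[𝕜] N) ⊗[𝕜] P}
    (hx : x ∈ kunneth 𝕜 (kunneth 𝕜 (posF 𝕜 𝒜) (posF 𝕜 ℬ)) (posF 𝕜 𝒞) n) : f x = g x := by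
  refine kunneth_eqOn (fun p k hpk y hy c hc => ?_) hx
  refine kunneth_eqOn (f := f ∘ₗ (TensorProduct.mk 𝕜 _ _).flip c)
    (g := g ∘ₗ (TensorProduct.mk 𝕜 _ _).flip c) (fun i j hij a ha b hb => ?_) hy
  rcases posF_cases hc with rfl | ⟨hk, hc⟩
  · simp
  rcases posF_cases ha with rfl | ⟨hi, ha⟩
  · simp
  rcases posF_cases hb with rfl | ⟨hj, hb⟩
  · simp
  exact h i j k hi hj hk (by omega) a ha b hb c hc

lemma kunneth_posF_right_eqOn {Q : Type} [AddCommGroup Q] [Module 𝕜 Q] {𝒜 : ℕ → Submodule 𝕜 M}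
    {ℬ : ℕ → Submodule 𝕜 N} {𝒞 : ℕ → Submodule 𝕜 P} {n : ℕ} {f g : M ⊗[𝕜] (N ⊗[𝕜] P) →ₗ[𝕜] Q}
    (h : ∀ i j k, i ≠ 0 → j ≠ 0 → k ≠ 0 → i + j + k = n → ∀ a ∈ 𝒜 i, ∀ b ∈ ℬ j, ∀ c ∈ 𝒞 k,
      f (a ⊗ₜ (b ⊗ₜ c)) = g (a ⊗ₜ (b ⊗ₜ c))) {x : M ⊗[𝕜] (N ⊗[𝕜] P)}
    (hx : x ∈ kunneth 𝕜 (posF 𝕜 𝒜) (kunneth 𝕜 (posF 𝕜 ℬ) (posF 𝕜 𝒞)) n) : f x = g x := by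
  refine kunneth_eqOn (fun i p hip a ha y hy => ?_) hx
  refine kunneth_eqOn (f := f ∘ₗ TensorProduct.mk 𝕜 _ _ a)
    (g := g ∘ₗ TensorProduct.mk 𝕜 _ _ a) (fun j k hjk b hb c hc => ?_) hy
  rcases posF_cases hc with rfl | ⟨hk, hc⟩
  · simp
  rcases posF_cases ha with rfl | ⟨hi, ha⟩
  · simp
  rcases posF_cases hb with rfl | ⟨hj, hb⟩
  · simp
  exact h i j k hi hj hk (by omega) a ha b hb c hc

end Kunneth

section Projection

variable {𝕜 A B}
variable (𝒜 : ℕ → Submodule 𝕜 A) (ℬ : ℕ → Submodule 𝕜 B) [GradedAlgebra 𝒜] [GradedAlgebra ℬ]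

/-- The linear map `∑ c i j ∘ (p i ⊗ p j)` over `i + j = n`, where `p` are the projections onto
homogeneous components. -/
def glue {P : Type} [AddCommGroup P] [Module 𝕜 P] (n : ℕ) (c : ℕ → ℕ → A ⊗[𝕜] B →ₗ[𝕜] P) :
    A ⊗[𝕜] B →ₗ[𝕜] P :=
  ∑ p ∈ Finset.HasAntidiagonal.antidiagonal n,
    c p.1 p.2 ∘ₗ TensorProduct.map (GradedAlgebra.proj 𝒜 p.1) (GradedAlgebra.proj ℬ p.2)

lemma proj_of_mem {i j : ℕ} {a : A} (ha : a ∈ 𝒜 i) :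
    GradedAlgebra.proj 𝒜 j a = if i = j then a else 0 := by
  rw [GradedAlgebra.proj_apply]
  split_ifs with h
  · subst h; exact DirectSum.decompose_of_mem_same 𝒜 ha
  · exact DirectSum.decompose_of_mem_ne 𝒜 ha h

lemma glue_tmul {P : Type} [AddCommGroup P] [Module 𝕜 P] {n : ℕ}
    (c : ℕ → ℕ → A ⊗[𝕜] B →ₗ[𝕜] P) {i j : ℕ} {a : A} {b : B} (ha : a ∈ 𝒜 i) (hb : b ∈ ℬ j) :
    glue 𝒜 ℬ n c (a ⊗ₜ b) = if i + j = n then c i j (a ⊗ₜ b) else 0 := by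
  simp only [glue, LinearMap.sum_apply, LinearMap.comp_apply, TensorProduct.map_tmul,
    proj_of_mem 𝒜 ha, proj_of_mem ℬ hb]
  split_ifs with h
  · rw [Finset.sum_eq_single (i, j)]
    · simp
    · rintro ⟨p, q⟩ - hne
      by_cases hp : i = p
      · have : j ≠ q := fun hq => hne (by rw [hp, hq])
        simp [this]
      · simp [hp]
    · simp [h]
  · refine Finset.sum_eq_zero ?_
    rintro ⟨p, q⟩ hpq
    rw [Finset.HasAntidiagonal.mem_antidiagonal] at hpq
    by_cases hp : i = p
    · have : j ≠ q := fun hq => h (by rw [hp, hq]; exact hpq)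
      simp [this]
    · simp [hp]

/-- The projection of `A ⊗ B` onto its degree `n` component. -/
def kproj (n : ℕ) : A ⊗[𝕜] B →ₗ[𝕜] A ⊗[𝕜] B := glue 𝒜 ℬ n fun _ _ => LinearMap.id

lemma kproj_eq_self {n : ℕ} {x : A ⊗[𝕜] B} (hx : x ∈ kunneth 𝕜 𝒜 ℬ n) :
    kproj 𝒜 ℬ n x = x :=
  kunneth_eqOn (g := LinearMap.id)
    (fun i j hij a ha b hb => by simp [kproj, glue_tmul 𝒜 ℬ _ ha hb, hij]) hx

lemma kproj_mem (n : ℕ) (x : A ⊗[𝕜] B) : kproj 𝒜 ℬ n x ∈ kunneth 𝕜 𝒜 ℬ n := by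
  induction x using TensorProduct.induction_on with
  | zero => simp
  | add x y hx hy => rw [map_add]; exact Submodule.add_mem _ hx hy
  | tmul a b =>
    simp only [kproj, glue, LinearMap.sum_apply, LinearMap.comp_apply, TensorProduct.map_tmul,
      LinearMap.id_apply]
    refine Submodule.sum_mem _ fun p hp => ?_
    refine tmul_mem_kunneth ?_ ?_ (Finset.HasAntidiagonal.mem_antidiagonal.1 hp)
    · rw [GradedAlgebra.proj_apply]; exact SetLike.coe_mem _
    · rw [GradedAlgebra.proj_apply]; exact SetLike.coe_mem _

end Projection

section Action

variable {𝕜 A B}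
variable (τ : B ⊗[𝕜] A →ₗ[𝕜] A ⊗[𝕜] B)

/-- The map `(μ_A ⊗ 1_B)(1_A ⊗ τ)` on `A ⊗ B ⊗ A`. -/
def actA : (A ⊗[𝕜] B) ⊗[𝕜] A →ₗ[𝕜] A ⊗[𝕜] B :=
  rTensor B (mul' 𝕜 A) ∘ₗ (TensorProduct.assoc 𝕜 A A B).symm.toLinearMap
    ∘ₗ lTensor A τ ∘ₗ (TensorProduct.assoc 𝕜 A B A).toLinearMap

/-- The map `(1_A ⊗ μ_B)(τ ⊗ 1_B)` on `B ⊗ A ⊗ B`. -/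
def actB : B ⊗[𝕜] (A ⊗[𝕜] B) →ₗ[𝕜] A ⊗[𝕜] B :=
  lTensor A (mul' 𝕜 B) ∘ₗ (TensorProduct.assoc 𝕜 A B B).toLinearMap
    ∘ₗ rTensor B τ ∘ₗ (TensorProduct.assoc 𝕜 B A B).symm.toLinearMap

lemma actA_tmul (a a' : A) (b : B) :
    actA τ ((a ⊗ₜ b) ⊗ₜ a') = rTensor B (mulLeft 𝕜 a) (τ (b ⊗ₜ a')) := by
  simp only [actA, LinearMap.comp_apply, LinearEquiv.coe_coe, TensorProduct.assoc_tmul,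
    lTensor_tmul]
  induction τ (b ⊗ₜ a') using TensorProduct.induction_on with
  | zero => simp
  | tmul c d => simp
  | add x y hx hy => rw [TensorProduct.tmul_add, map_add, map_add, map_add, hx, hy]

lemma actB_tmul (b b' : B) (a : A) :
    actB τ (b ⊗ₜ (a ⊗ₜ b')) = lTensor A (mulRight 𝕜 b') (τ (b ⊗ₜ a)) := by
  simp only [actB, LinearMap.comp_apply, LinearEquiv.coe_coe, TensorProduct.assoc_symm_tmul,
    rTensor_tmul]
  induction τ (b ⊗ₜ a) using TensorProduct.induction_on with
  | zero => simp
  | tmul c d => simp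
  | add x y hx hy => rw [TensorProduct.add_tmul, map_add, map_add, map_add, hx, hy]

lemma mulTau_tmul (x : A ⊗[𝕜] B) (c : A) (d : B) :
    mulTau 𝕜 A B τ (x ⊗ₜ (c ⊗ₜ d)) = lTensor A (mulRight 𝕜 d) (actA τ (x ⊗ₜ c)) := by
  induction x using TensorProduct.induction_on with
  | zero => simp
  | add x y hx hy =>
    rw [TensorProduct.add_tmul, map_add, hx, hy, TensorProduct.add_tmul, map_add, map_add]
  | tmul a b =>
    rw [actA_tmul]
    simp only [mulTau, LinearMap.comp_apply, LinearEquiv.coe_coe, TensorProduct.assoc_tmul,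
      lTensor_tmul, TensorProduct.assoc_symm_tmul, rTensor_tmul]
    induction τ (b ⊗ₜ c) using TensorProduct.induction_on with
    | zero => simp
    | tmul e f => simp
    | add x y hx hy =>
      rw [TensorProduct.add_tmul, map_add, TensorProduct.tmul_add, map_add, map_add, map_add,
        map_add, hx, hy]

lemma mulTau_one_tmul (b : B) (y : A ⊗[𝕜] B) :
    mulTau 𝕜 A B τ ((1 ⊗ₜ b) ⊗ₜ y) = actB τ (b ⊗ₜ y) := by
  induction y using TensorProduct.induction_on with
  | zero => simp
  | add x y hx hy => rw [TensorProduct.tmul_add, TensorProduct.tmul_add, map_add, map_add, hx, hy]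
  | tmul c d =>
    rw [mulTau_tmul, actA_tmul, actB_tmul, LinearMap.mulLeft_one, LinearMap.rTensor_id,
      LinearMap.id_apply]

/-- The part of the right-hand side of the twisting identity that follows the first
application of `τ`. -/
def twistTail (b : B) (a' : A) : A ⊗[𝕜] B →ₗ[𝕜] A ⊗[𝕜] B :=
  mulTau 𝕜 A B τ ∘ₗ TensorProduct.map (τ ∘ₗ TensorProduct.mk 𝕜 B A b)
    (τ ∘ₗ (TensorProduct.mk 𝕜 B A).flip a')

lemma twistRHS_tmul (b b' : B) (a a' : A) :
    twistRHS 𝕜 A B τ ((b ⊗ₜ b') ⊗ₜ (a ⊗ₜ a')) = twistTail τ b a' (τ (b' ⊗ₜ a)) := by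
  simp only [twistRHS, twistTail, mulTau, LinearMap.comp_apply, LinearEquiv.coe_coe,
    TensorProduct.assoc_tmul, lTensor_tmul, TensorProduct.assoc_symm_tmul, rTensor_tmul]
  induction τ (b' ⊗ₜ a) using TensorProduct.induction_on with
  | zero => simp
  | tmul c d => simp
  | add x y hx hy =>
    simp only [TensorProduct.add_tmul, TensorProduct.tmul_add, map_add, hx, hy]

lemma twistLHS_tmul (b b' : B) (a a' : A) :
    twistLHS 𝕜 A B τ ((b ⊗ₜ b') ⊗ₜ (a ⊗ₜ a')) = τ ((b * b') ⊗ₜ (a * a')) := by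
  simp [twistLHS]

lemma Rmap1_tmul (εA : A →ₗ[𝕜] 𝕜) (b : B) (a a' : A) :
    Rmap1 𝕜 A B εA τ ((b ⊗ₜ a) ⊗ₜ a') =
      actA τ ((τ (b ⊗ₜ a) - 1 ⊗ₜ tBmap 𝕜 A B εA τ (b ⊗ₜ a)) ⊗ₜ a') := rfl

lemma Rmap2_tmul (εB : B →ₗ[𝕜] 𝕜) (b b' : B) (a : A) :
    Rmap2 𝕜 A B εB τ (b ⊗ₜ (b' ⊗ₜ a)) =
      actB τ (b ⊗ₜ (τ (b' ⊗ₜ a) - tAmap 𝕜 A B εB τ (b' ⊗ₜ a) ⊗ₜ 1)) := rfl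

lemma delta1_tmul (εA : A →ₗ[𝕜] 𝕜) (b : B) (a a' : A) :
    delta1 𝕜 A B εA τ ((b ⊗ₜ a) ⊗ₜ a') =
      b ⊗ₜ (a * a') - tBmap 𝕜 A B εA τ (b ⊗ₜ a) ⊗ₜ a' := by
  simp [delta1]

lemma delta2_tmul (εB : B →ₗ[𝕜] 𝕜) (b b' : B) (a : A) :
    delta2 𝕜 A B εB τ (b ⊗ₜ (b' ⊗ₜ a)) =
      (b * b') ⊗ₜ a - b ⊗ₜ tAmap 𝕜 A B εB τ (b' ⊗ₜ a) := by
  simp [delta2]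

/-- Multiplicativity of `τ` in `A` amounts to `τ ∘ δ = R` on the first summand. -/
lemma apply_delta1_eq_iff (εA : A →ₗ[𝕜] 𝕜) (b : B) (a a' : A) :
    τ (delta1 𝕜 A B εA τ ((b ⊗ₜ a) ⊗ₜ a')) = Rmap1 𝕜 A B εA τ ((b ⊗ₜ a) ⊗ₜ a') ↔
      τ (b ⊗ₜ (a * a')) = actA τ (τ (b ⊗ₜ a) ⊗ₜ a') := by
  rw [delta1_tmul, Rmap1_tmul, TensorProduct.sub_tmul, map_sub, map_sub, actA_tmul,
    LinearMap.mulLeft_one, LinearMap.rTensor_id, LinearMap.id_apply, sub_left_inj]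

/-- Multiplicativity of `τ` in `B` amounts to `τ ∘ δ = R` on the second summand. -/
lemma apply_delta2_eq_iff (εB : B →ₗ[𝕜] 𝕜) (b b' : B) (a : A) :
    τ (delta2 𝕜 A B εB τ (b ⊗ₜ (b' ⊗ₜ a))) = Rmap2 𝕜 A B εB τ (b ⊗ₜ (b' ⊗ₜ a)) ↔
      τ ((b * b') ⊗ₜ a) = actB τ (b ⊗ₜ τ (b' ⊗ₜ a)) := by
  rw [delta2_tmul, Rmap2_tmul, TensorProduct.tmul_sub, map_sub, map_sub, actB_tmul,
    LinearMap.mulRight_one, LinearMap.lTensor_id, LinearMap.id_apply, sub_left_inj]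

end Action

section Twisting

variable {𝕜 A B}
variable {𝒜 : ℕ → Submodule 𝕜 A} {ℬ : ℕ → Submodule 𝕜 B}
variable {τ : B ⊗[𝕜] A →ₗ[𝕜] A ⊗[𝕜] B} {m : ℕ}

lemma IsGradedMapBA.apply_tmul_mem (hg : IsGradedMapBA 𝕜 A B 𝒜 ℬ τ) {i j : ℕ} {b : B} {a : A}
    (hb : b ∈ ℬ i) (ha : a ∈ 𝒜 j) : τ (b ⊗ₜ a) ∈ kunneth 𝕜 𝒜 ℬ (i + j) :=
  hg _ (Submodule.mem_map_of_mem (tmul_mem_kunneth hb ha rfl))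

lemma TwistingToDeg.apply_mul_right [GradedAlgebra ℬ] (ht : TwistingToDeg 𝕜 A B 𝒜 ℬ τ m) {i j k : ℕ}
    (h : i + j + k ≤ m) {b : B} {a a' : A} (hb : b ∈ ℬ i) (ha : a ∈ 𝒜 j) (ha' : a' ∈ 𝒜 k) :
    τ (b ⊗ₜ (a * a')) = actA τ (τ (b ⊗ₜ a) ⊗ₜ a') := by
  have := ht.2.2.2 (i + j + k) h ((b ⊗ₜ 1) ⊗ₜ (a ⊗ₜ a'))
    (tmul_mem_kunneth (tmul_mem_kunneth hb SetLike.GradedOne.one_mem rfl)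
      (tmul_mem_kunneth ha ha' rfl) (by omega))
  rw [twistLHS_tmul, twistRHS_tmul, ht.2.1 j (by omega) a ha, mul_one] at this
  rw [this, twistTail]
  simp [ht.2.1 k (by omega) a' ha', mulTau_tmul]

lemma TwistingToDeg.apply_mul_left [GradedAlgebra 𝒜] (ht : TwistingToDeg 𝕜 A B 𝒜 ℬ τ m) {i j k : ℕ}
    (h : i + j + k ≤ m) {b b' : B} {a : A} (hb : b ∈ ℬ i) (hb' : b' ∈ ℬ j) (ha : a ∈ 𝒜 k) :
    τ ((b * b') ⊗ₜ a) = actB τ (b ⊗ₜ τ (b' ⊗ₜ a)) := by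
  have := ht.2.2.2 (i + j + k) h ((b ⊗ₜ b') ⊗ₜ (1 ⊗ₜ a))
    (tmul_mem_kunneth (tmul_mem_kunneth hb hb' rfl)
      (tmul_mem_kunneth SetLike.GradedOne.one_mem ha rfl) (by omega))
  rw [twistLHS_tmul, twistRHS_tmul, ht.2.2.1 j (by omega) b' hb', one_mul] at this
  rw [this, twistTail]
  simp [ht.2.2.1 i (by omega) b hb, mulTau_one_tmul]

/-- A graded map compatible with units and with multiplication in each variable separately
satisfies the twisting identity. -/
lemma twistingToDeg_of_mul [GradedAlgebra 𝒜] (hg : IsGradedMapBA 𝕜 A B 𝒜 ℬ τ)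
    (hA : ∀ j ≤ m, ∀ a ∈ 𝒜 j, τ ((1 : B) ⊗ₜ[𝕜] a) = a ⊗ₜ[𝕜] (1 : B))
    (hB : ∀ j ≤ m, ∀ b ∈ ℬ j, τ (b ⊗ₜ[𝕜] (1 : A)) = (1 : A) ⊗ₜ[𝕜] b)
    (hmA : ∀ i j k, i + j + k ≤ m → ∀ b ∈ ℬ i, ∀ a ∈ 𝒜 j, ∀ a' ∈ 𝒜 k,
      τ (b ⊗ₜ (a * a')) = actA τ (τ (b ⊗ₜ a) ⊗ₜ a'))
    (hmB : ∀ i j k, i + j + k ≤ m → ∀ b ∈ ℬ i, ∀ b' ∈ ℬ j, ∀ a ∈ 𝒜 k,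
      τ ((b * b') ⊗ₜ a) = actB τ (b ⊗ₜ τ (b' ⊗ₜ a))) :
    TwistingToDeg 𝕜 A B 𝒜 ℬ τ m := by
  refine ⟨hg, hA, hB, fun N hN x hx => kunneth_eqOn (fun p q hpq y hy z hz => ?_) hx⟩
  refine kunneth_eqOn (f := twistLHS 𝕜 A B τ ∘ₗ (TensorProduct.mk 𝕜 _ _).flip z)
    (g := twistRHS 𝕜 A B τ ∘ₗ (TensorProduct.mk 𝕜 _ _).flip z)
    (fun i j hij b hb b' hb' => ?_) hy
  refine kunneth_eqOn (f := twistLHS 𝕜 A B τ ∘ₗ TensorProduct.mk 𝕜 _ _ (b ⊗ₜ b'))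
    (g := twistRHS 𝕜 A B τ ∘ₗ TensorProduct.mk 𝕜 _ _ (b ⊗ₜ b'))
    (fun k l hkl a ha a' ha' => ?_) hz
  simp only [LinearMap.comp_apply, TensorProduct.mk_apply, twistLHS_tmul, twistRHS_tmul]
  rw [hmB i j (k + l) (by omega) b hb b' hb' _ (SetLike.mul_mem_graded ha ha'),
    hmA j k l (by omega) b' hb' a ha a' ha']
  refine kunneth_eqOn (f := actB τ ∘ₗ TensorProduct.mk 𝕜 _ _ b ∘ₗ actA τ ∘ₗ
    (TensorProduct.mk 𝕜 _ _).flip a') (fun r s hrs c hc d hd => ?_) (hg.apply_tmul_mem hb' ha)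
  simp only [LinearMap.comp_apply, TensorProduct.mk_apply, LinearMap.flip_apply, actA_tmul,
    twistTail, TensorProduct.map_tmul]
  refine kunneth_eqOn (f := actB τ ∘ₗ TensorProduct.mk 𝕜 _ _ b ∘ₗ rTensor B (mulLeft 𝕜 c))
    (g := mulTau 𝕜 A B τ ∘ₗ TensorProduct.mk 𝕜 _ _ (τ (b ⊗ₜ c)))
    (fun u v huv e he f hf => ?_) (hg.apply_tmul_mem hd ha')
  simp only [LinearMap.comp_apply, TensorProduct.mk_apply, rTensor_tmul, mulLeft_apply,
    actB_tmul, mulTau_tmul]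
  rw [hmA i r u (by omega) b hb c hc e he]

end Twisting

section Extension

variable {𝕜 A B}
variable {𝒜 : ℕ → Submodule 𝕜 A} {ℬ : ℕ → Submodule 𝕜 B}
variable {t t' : B ⊗[𝕜] A →ₗ[𝕜] A ⊗[𝕜] B} {n : ℕ}

lemma delta1_congr (εA : A →ₗ[𝕜] 𝕜) (h : ∀ i ≤ n, ∀ x ∈ kunneth 𝕜 ℬ 𝒜 i, t' x = t x)
    {i j : ℕ} (hij : i + j ≤ n) {b : B} {a : A} (hb : b ∈ ℬ i) (ha : a ∈ 𝒜 j) (a' : A) :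
    delta1 𝕜 A B εA t' ((b ⊗ₜ a) ⊗ₜ a') = delta1 𝕜 A B εA t ((b ⊗ₜ a) ⊗ₜ a') := by
  simp [delta1_tmul, tBmap, h _ hij _ (tmul_mem_kunneth hb ha rfl)]

lemma delta2_congr (εB : B →ₗ[𝕜] 𝕜) (h : ∀ i ≤ n, ∀ x ∈ kunneth 𝕜 ℬ 𝒜 i, t' x = t x)
    {i j : ℕ} (hij : i + j ≤ n) {b' : B} {a : A} (hb' : b' ∈ ℬ i) (ha : a ∈ 𝒜 j) (b : B) :
    delta2 𝕜 A B εB t' (b ⊗ₜ (b' ⊗ₜ a)) = delta2 𝕜 A B εB t (b ⊗ₜ (b' ⊗ₜ a)) := by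
  simp [delta2_tmul, tAmap, h _ hij _ (tmul_mem_kunneth hb' ha rfl)]

lemma actA_congr (h : ∀ i ≤ n, ∀ x ∈ kunneth 𝕜 ℬ 𝒜 i, t' x = t x) {𝒜' : ℕ → Submodule 𝕜 A}
    {p k : ℕ} (hpk : ∀ i j, i + j = p → j + k ≤ n ∨ 𝒜' i = ⊥) {x : A ⊗[𝕜] B}
    (hx : x ∈ kunneth 𝕜 𝒜' ℬ p) {a : A} (ha : a ∈ 𝒜 k) :
    actA t' (x ⊗ₜ a) = actA t (x ⊗ₜ a) := by
  refine kunneth_eqOn (f := actA t' ∘ₗ (TensorProduct.mk 𝕜 _ _).flip a)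
    (g := actA t ∘ₗ (TensorProduct.mk 𝕜 _ _).flip a) (fun i j hij c hc d hd => ?_) hx
  simp only [LinearMap.comp_apply, LinearMap.flip_apply, TensorProduct.mk_apply, actA_tmul]
  rcases hpk i j hij with hle | hbot
  · rw [h _ hle _ (tmul_mem_kunneth hd ha rfl)]
  · rw [hbot, Submodule.mem_bot] at hc
    simp [hc]

lemma actB_congr (h : ∀ i ≤ n, ∀ x ∈ kunneth 𝕜 ℬ 𝒜 i, t' x = t x) {ℬ' : ℕ → Submodule 𝕜 B}
    {p k : ℕ} (hpk : ∀ i j, i + j = p → k + i ≤ n ∨ ℬ' j = ⊥) {x : A ⊗[𝕜] B}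
    (hx : x ∈ kunneth 𝕜 𝒜 ℬ' p) {b : B} (hb : b ∈ ℬ k) :
    actB t' (b ⊗ₜ x) = actB t (b ⊗ₜ x) := by
  refine kunneth_eqOn (f := actB t' ∘ₗ TensorProduct.mk 𝕜 _ _ b)
    (g := actB t ∘ₗ TensorProduct.mk 𝕜 _ _ b) (fun i j hij c hc d hd => ?_) hx
  simp only [LinearMap.comp_apply, TensorProduct.mk_apply, actB_tmul]
  rcases hpk i j hij with hle | hbot
  · rw [h _ hle _ (tmul_mem_kunneth hb hc rfl)]
  · rw [hbot, Submodule.mem_bot] at hd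
    simp [hd]

lemma Rmap1_congr {εA : A →ₗ[𝕜] 𝕜} (hεA0 : ∀ x ∈ 𝒜 0, εA x • (1 : A) = x)
    (hεAp : ∀ j, 0 < j → ∀ x ∈ 𝒜 j, εA x = 0) (hg : IsGradedMapBA 𝕜 A B 𝒜 ℬ t)
    (h : ∀ i ≤ n, ∀ x ∈ kunneth 𝕜 ℬ 𝒜 i, t' x = t x) {i j k : ℕ} (hij : i + j ≤ n)
    (hijk : i + j + k ≤ n + 1) {b : B} {a a' : A} (hb : b ∈ ℬ i) (ha : a ∈ 𝒜 j)
    (ha' : a' ∈ 𝒜 k) :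
    Rmap1 𝕜 A B εA t' ((b ⊗ₜ a) ⊗ₜ a') = Rmap1 𝕜 A B εA t ((b ⊗ₜ a) ⊗ₜ a') := by
  simp only [Rmap1_tmul, tBmap, LinearMap.comp_apply, h _ hij _ (tmul_mem_kunneth hb ha rfl)]
  refine actA_congr h (fun p q hpq => ?_)
    (sub_mem_kunneth_posF_left hεA0 hεAp (hg.apply_tmul_mem hb ha)) ha'
  by_cases hp : p = 0
  · right; simp [posF, hp]
  · left; omega

lemma Rmap2_congr {εB : B →ₗ[𝕜] 𝕜} (hεB0 : ∀ x ∈ ℬ 0, εB x • (1 : B) = x)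
    (hεBp : ∀ j, 0 < j → ∀ x ∈ ℬ j, εB x = 0) (hg : IsGradedMapBA 𝕜 A B 𝒜 ℬ t)
    (h : ∀ i ≤ n, ∀ x ∈ kunneth 𝕜 ℬ 𝒜 i, t' x = t x) {i j k : ℕ} (hjk : j + k ≤ n)
    (hijk : i + j + k ≤ n + 1) {b b' : B} {a : A} (hb : b ∈ ℬ i) (hb' : b' ∈ ℬ j)
    (ha : a ∈ 𝒜 k) :
    Rmap2 𝕜 A B εB t' (b ⊗ₜ (b' ⊗ₜ a)) = Rmap2 𝕜 A B εB t (b ⊗ₜ (b' ⊗ₜ a)) := by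
  simp only [Rmap2_tmul, tAmap, LinearMap.comp_apply, h _ hjk _ (tmul_mem_kunneth hb' ha rfl)]
  refine actB_congr h (fun p q hpq => ?_)
    (sub_mem_kunneth_posF_right hεB0 hεBp (hg.apply_tmul_mem hb' ha)) hb
  by_cases hq : q = 0
  · right; simp [posF, hq]
  · left; omega

lemma actA_mem [GradedAlgebra 𝒜] (hg : IsGradedMapBA 𝕜 A B 𝒜 ℬ t) {p k : ℕ} {x : A ⊗[𝕜] B}
    (hx : x ∈ kunneth 𝕜 𝒜 ℬ p) {a : A} (ha : a ∈ 𝒜 k) :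
    actA t (x ⊗ₜ a) ∈ kunneth 𝕜 𝒜 ℬ (p + k) := by
  refine kunneth_le (S := Submodule.comap (actA t ∘ₗ (TensorProduct.mk 𝕜 _ _).flip a)
    (kunneth 𝕜 𝒜 ℬ (p + k))) (fun i j hij c hc d hd => ?_) hx
  simp only [Submodule.mem_comap, LinearMap.comp_apply, LinearMap.flip_apply,
    TensorProduct.mk_apply, actA_tmul]
  refine kunneth_le (S := Submodule.comap (rTensor B (mulLeft 𝕜 c)) (kunneth 𝕜 𝒜 ℬ (p + k)))
    (fun u v huv e he f hf => ?_) (hg.apply_tmul_mem hd ha)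
  simpa using tmul_mem_kunneth (SetLike.mul_mem_graded hc he) hf (by omega)

lemma actB_mem [GradedAlgebra ℬ] (hg : IsGradedMapBA 𝕜 A B 𝒜 ℬ t) {p k : ℕ} {x : A ⊗[𝕜] B}
    (hx : x ∈ kunneth 𝕜 𝒜 ℬ p) {b : B} (hb : b ∈ ℬ k) :
    actB t (b ⊗ₜ x) ∈ kunneth 𝕜 𝒜 ℬ (k + p) := by
  refine kunneth_le (S := Submodule.comap (actB t ∘ₗ TensorProduct.mk 𝕜 _ _ b)
    (kunneth 𝕜 𝒜 ℬ (k + p))) (fun i j hij c hc d hd => ?_) hx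
  simp only [Submodule.mem_comap, LinearMap.comp_apply, TensorProduct.mk_apply, actB_tmul]
  refine kunneth_le (S := Submodule.comap (lTensor A (mulRight 𝕜 d)) (kunneth 𝕜 𝒜 ℬ (k + p)))
    (fun u v huv e he f hf => ?_) (hg.apply_tmul_mem hb hc)
  simpa using tmul_mem_kunneth he (SetLike.mul_mem_graded hf hd) (by omega)

lemma actA_one {m : ℕ} (hB : ∀ j ≤ m, ∀ b ∈ ℬ j, t (b ⊗ₜ[𝕜] (1 : A)) = (1 : A) ⊗ₜ[𝕜] b)
    {p : ℕ} (hp : p ≤ m) {x : A ⊗[𝕜] B} (hx : x ∈ kunneth 𝕜 𝒜 ℬ p) : actA t (x ⊗ₜ 1) = x := by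
  refine kunneth_eqOn (f := actA t ∘ₗ (TensorProduct.mk 𝕜 _ _).flip 1) (g := LinearMap.id)
    (fun i j hij c hc d hd => ?_) hx
  simp [actA_tmul, hB j (by omega) d hd]

lemma actB_one {m : ℕ} (hA : ∀ j ≤ m, ∀ a ∈ 𝒜 j, t ((1 : B) ⊗ₜ[𝕜] a) = a ⊗ₜ[𝕜] (1 : B))
    {p : ℕ} (hp : p ≤ m) {x : A ⊗[𝕜] B} (hx : x ∈ kunneth 𝕜 𝒜 ℬ p) : actB t (1 ⊗ₜ x) = x := by
  refine kunneth_eqOn (f := actB t ∘ₗ TensorProduct.mk 𝕜 _ _ 1) (g := LinearMap.id)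
    (fun i j hij c hc d hd => ?_) hx
  simp [actB_tmul, hA i (by omega) c hc]

lemma Rmap1_mem [GradedAlgebra 𝒜] {εA : A →ₗ[𝕜] 𝕜} (hεA0 : ∀ x ∈ 𝒜 0, εA x • (1 : A) = x)
    (hεAp : ∀ j, 0 < j → ∀ x ∈ 𝒜 j, εA x = 0) (hg : IsGradedMapBA 𝕜 A B 𝒜 ℬ t)
    {i j k : ℕ} {b : B} {a a' : A} (hb : b ∈ ℬ i) (ha : a ∈ 𝒜 j) (ha' : a' ∈ 𝒜 k) :
    Rmap1 𝕜 A B εA t ((b ⊗ₜ a) ⊗ₜ a') ∈ kunneth 𝕜 𝒜 ℬ (i + j + k) :=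
  actA_mem hg (kunneth_mono (posF_le 𝒜) (fun _ => le_rfl) _
    (sub_mem_kunneth_posF_left hεA0 hεAp (hg.apply_tmul_mem hb ha))) ha'

lemma Rmap2_mem [GradedAlgebra ℬ] {εB : B →ₗ[𝕜] 𝕜} (hεB0 : ∀ x ∈ ℬ 0, εB x • (1 : B) = x)
    (hεBp : ∀ j, 0 < j → ∀ x ∈ ℬ j, εB x = 0) (hg : IsGradedMapBA 𝕜 A B 𝒜 ℬ t)
    {i j k : ℕ} {b b' : B} {a : A} (hb : b ∈ ℬ i) (hb' : b' ∈ ℬ j) (ha : a ∈ 𝒜 k) :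
    Rmap2 𝕜 A B εB t (b ⊗ₜ (b' ⊗ₜ a)) ∈ kunneth 𝕜 𝒜 ℬ (i + (j + k)) :=
  actB_mem hg (kunneth_mono (fun _ => le_rfl) (posF_le ℬ) _
    (sub_mem_kunneth_posF_right hεB0 hεBp (hg.apply_tmul_mem hb' ha))) hb

lemma delta1_mem [GradedAlgebra 𝒜] {εA : A →ₗ[𝕜] 𝕜}
    (hεAp : ∀ j, 0 < j → ∀ x ∈ 𝒜 j, εA x = 0) (hg : IsGradedMapBA 𝕜 A B 𝒜 ℬ t)
    {i j k : ℕ} (hi : i ≠ 0) (hk : k ≠ 0) {b : B} {a a' : A} (hb : b ∈ ℬ i) (ha : a ∈ 𝒜 j)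
    (ha' : a' ∈ 𝒜 k) :
    delta1 𝕜 A B εA t ((b ⊗ₜ a) ⊗ₜ a') ∈ kunneth 𝕜 (posF 𝕜 ℬ) (posF 𝕜 𝒜) (i + j + k) := by
  rw [delta1_tmul]
  refine Submodule.sub_mem _ ?_ ?_
  · exact tmul_mem_kunneth ((mem_posF hi).2 hb)
      ((mem_posF (by omega)).2 (SetLike.mul_mem_graded ha ha')) (by omega)
  · exact tmul_mem_kunneth ((mem_posF (by omega)).2 (lid_map_mem hεAp (hg.apply_tmul_mem hb ha)))
      ((mem_posF hk).2 ha') rfl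

lemma delta2_mem [GradedAlgebra ℬ] {εB : B →ₗ[𝕜] 𝕜}
    (hεBp : ∀ j, 0 < j → ∀ x ∈ ℬ j, εB x = 0) (hg : IsGradedMapBA 𝕜 A B 𝒜 ℬ t)
    {i j k : ℕ} (hi : i ≠ 0) (hk : k ≠ 0) {b b' : B} {a : A} (hb : b ∈ ℬ i) (hb' : b' ∈ ℬ j)
    (ha : a ∈ 𝒜 k) :
    delta2 𝕜 A B εB t (b ⊗ₜ (b' ⊗ₜ a)) ∈
      kunneth 𝕜 (posF 𝕜 ℬ) (posF 𝕜 𝒜) (i + (j + k)) := by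
  rw [delta2_tmul]
  refine Submodule.sub_mem _ ?_ ?_
  · exact tmul_mem_kunneth ((mem_posF (by omega)).2 (SetLike.mul_mem_graded hb hb'))
      ((mem_posF hk).2 ha) (by omega)
  · exact tmul_mem_kunneth ((mem_posF hi).2 hb)
      ((mem_posF (by omega)).2 (rid_map_mem hεBp (hg.apply_tmul_mem hb' ha))) rfl

lemma ExtCond.apply_delta1 [GradedAlgebra ℬ] {εA : A →ₗ[𝕜] 𝕜}
    (hεA0 : ∀ x ∈ 𝒜 0, εA x • (1 : A) = x) (hεAp : ∀ j, 0 < j → ∀ x ∈ 𝒜 j, εA x = 0)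
    (hg : IsGradedMapBA 𝕜 A B 𝒜 ℬ t) (h : ExtCond 𝕜 A B 𝒜 ℬ t t' n) :
    ∀ x ∈ kunneth 𝕜 (kunneth 𝕜 (posF 𝕜 ℬ) (posF 𝕜 𝒜)) (posF 𝕜 𝒜) (n + 1),
      t' (delta1 𝕜 A B εA t x) = Rmap1 𝕜 A B εA t x := fun x hx => by
  refine kunneth_posF_left_eqOn (f := t' ∘ₗ delta1 𝕜 A B εA t)
    (fun i j k hi hj hk hijk b hb a ha a' ha' => ?_) hx
  rw [LinearMap.comp_apply, ← delta1_congr εA h.2 (by omega) hb ha,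
    ← Rmap1_congr hεA0 hεAp hg h.2 (by omega) hijk.le hb ha ha', apply_delta1_eq_iff]
  exact h.1.apply_mul_right hijk.le hb ha ha'

lemma ExtCond.apply_delta2 [GradedAlgebra 𝒜] {εB : B →ₗ[𝕜] 𝕜}
    (hεB0 : ∀ x ∈ ℬ 0, εB x • (1 : B) = x) (hεBp : ∀ j, 0 < j → ∀ x ∈ ℬ j, εB x = 0)
    (hg : IsGradedMapBA 𝕜 A B 𝒜 ℬ t) (h : ExtCond 𝕜 A B 𝒜 ℬ t t' n) :
    ∀ y ∈ kunneth 𝕜 (posF 𝕜 ℬ) (kunneth 𝕜 (posF 𝕜 ℬ) (posF 𝕜 𝒜)) (n + 1),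
      t' (delta2 𝕜 A B εB t y) = Rmap2 𝕜 A B εB t y := fun x hx => by
  refine kunneth_posF_right_eqOn (f := t' ∘ₗ delta2 𝕜 A B εB t)
    (fun i j k hi hj hk hijk b hb b' hb' a ha => ?_) hx
  rw [LinearMap.comp_apply, ← delta2_congr εB h.2 (by omega) hb' ha,
    ← Rmap2_congr hεB0 hεBp hg h.2 (by omega) hijk.le hb hb' ha, apply_delta2_eq_iff]
  exact h.1.apply_mul_left hijk.le hb hb' ha

/-- A solution `f` of `f ∘ δ = R` in degree `n + 1` yields a twisting extension, given on
`(B₊ ⊗ A₊)` by the degree `n + 1` part of `f`. -/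
lemma exists_extCond [GradedAlgebra 𝒜] [GradedAlgebra ℬ]
    {εA : A →ₗ[𝕜] 𝕜} (hεA0 : ∀ x ∈ 𝒜 0, εA x • (1 : A) = x)
    (hεAp : ∀ j, 0 < j → ∀ x ∈ 𝒜 j, εA x = 0)
    {εB : B →ₗ[𝕜] 𝕜} (hεB0 : ∀ x ∈ ℬ 0, εB x • (1 : B) = x)
    (hεBp : ∀ j, 0 < j → ∀ x ∈ ℬ j, εB x = 0)
    (ht : TwistingToDeg 𝕜 A B 𝒜 ℬ t n) {f : B ⊗[𝕜] A →ₗ[𝕜] A ⊗[𝕜] B}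
    (hf1 : ∀ x ∈ kunneth 𝕜 (kunneth 𝕜 (posF 𝕜 ℬ) (posF 𝕜 𝒜)) (posF 𝕜 𝒜) (n + 1),
      f (delta1 𝕜 A B εA t x) = Rmap1 𝕜 A B εA t x)
    (hf2 : ∀ y ∈ kunneth 𝕜 (posF 𝕜 ℬ) (kunneth 𝕜 (posF 𝕜 ℬ) (posF 𝕜 𝒜)) (n + 1),
      f (delta2 𝕜 A B εB t y) = Rmap2 𝕜 A B εB t y) :
    ∃ t', ExtCond 𝕜 A B 𝒜 ℬ t t' n ∧
      ∀ x ∈ kunneth 𝕜 (posF 𝕜 ℬ) (posF 𝕜 𝒜) (n + 1), t' x = kproj 𝒜 ℬ (n + 1) (f x) := by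
  let c : ℕ → ℕ → B ⊗[𝕜] A →ₗ[𝕜] A ⊗[𝕜] B := fun i j =>
    if i = 0 ∨ j = 0 then (TensorProduct.comm 𝕜 B A).toLinearMap else kproj 𝒜 ℬ (n + 1) ∘ₗ f
  obtain ⟨t', hne, heq⟩ : ∃ t' : B ⊗[𝕜] A →ₗ[𝕜] A ⊗[𝕜] B,
      (∀ i j, i + j ≠ n + 1 → ∀ b ∈ ℬ i, ∀ a ∈ 𝒜 j, t' (b ⊗ₜ a) = t (b ⊗ₜ a)) ∧
      (∀ i j, i + j = n + 1 → ∀ b ∈ ℬ i, ∀ a ∈ 𝒜 j, t' (b ⊗ₜ a) = c i j (b ⊗ₜ a)) := by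
    refine ⟨t + glue ℬ 𝒜 (n + 1) fun i j => c i j - t, fun i j hij b hb a ha => ?_,
      fun i j hij b hb a ha => ?_⟩
    · simp [glue_tmul ℬ 𝒜 _ hb ha, hij]
    · simp [glue_tmul ℬ 𝒜 _ hb ha, hij]
  have hle : ∀ i ≤ n, ∀ x ∈ kunneth 𝕜 ℬ 𝒜 i, t' x = t x := fun i hi x hx =>
    kunneth_eqOn (fun p q hpq b hb a ha => hne p q (by omega) b hb a ha) hx
  have hpos : ∀ x ∈ kunneth 𝕜 (posF 𝕜 ℬ) (posF 𝕜 𝒜) (n + 1),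
      t' x = kproj 𝒜 ℬ (n + 1) (f x) := fun x hx =>
    kunneth_eqOn (g := kproj 𝒜 ℬ (n + 1) ∘ₗ f) (fun p q hpq b hb a ha => by
      rcases posF_cases hb with rfl | ⟨hp, hb⟩
      · simp
      rcases posF_cases ha with rfl | ⟨hq, ha⟩
      · simp
      simp [heq p q hpq b hb a ha, c, hp, hq]) hx
  have hg : IsGradedMapBA 𝕜 A B 𝒜 ℬ t' := by
    refine fun m => Submodule.map_le_iff_le_comap.2 (kunneth_le fun i j hij b hb a ha => ?_)
    rw [Submodule.mem_comap]
    by_cases hm : i + j = n + 1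
    · rw [heq i j hm b hb a ha]
      by_cases h0 : i = 0 ∨ j = 0
      · simpa [c, h0] using tmul_mem_kunneth ha hb (by omega)
      · obtain rfl : m = n + 1 := by omega
        simpa [c, h0] using kproj_mem 𝒜 ℬ (n + 1) (f (b ⊗ₜ a))
    · rw [hne i j hm b hb a ha, ← hij]
      exact IsGradedMapBA.apply_tmul_mem ht.1 hb ha
  have hA : ∀ j ≤ n + 1, ∀ a ∈ 𝒜 j, t' ((1 : B) ⊗ₜ[𝕜] a) = a ⊗ₜ[𝕜] (1 : B) := by
    intro j hj a ha
    rcases hj.lt_or_eq with hj | rfl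
    · rw [hne 0 j (by omega) 1 SetLike.GradedOne.one_mem a ha, ht.2.1 j (by omega) a ha]
    · simp [heq 0 (n + 1) (by omega) 1 SetLike.GradedOne.one_mem a ha, c]
  have hB : ∀ j ≤ n + 1, ∀ b ∈ ℬ j, t' (b ⊗ₜ[𝕜] (1 : A)) = (1 : A) ⊗ₜ[𝕜] b := by
    intro j hj b hb
    rcases hj.lt_or_eq with hj | rfl
    · rw [hne j 0 (by omega) b hb 1 SetLike.GradedOne.one_mem, ht.2.2.1 j (by omega) b hb]
    · simp [heq (n + 1) 0 (by omega) b hb 1 SetLike.GradedOne.one_mem, c]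
  refine ⟨t', ⟨twistingToDeg_of_mul hg hA hB (fun i j k hijk b hb a ha a' ha' => ?_)
    (fun i j k hijk b hb b' hb' a ha => ?_), hle⟩, hpos⟩
  · rcases hijk.lt_or_eq with hlt | hijk'
    · rw [hne i (j + k) (by omega) b hb _ (SetLike.mul_mem_graded ha ha'),
        hne i j (by omega) b hb a ha, ht.apply_mul_right (by omega) hb ha ha',
        actA_congr hle (fun p q hpq => Or.inl (by omega))
          (IsGradedMapBA.apply_tmul_mem ht.1 hb ha) ha']
    by_cases hi : i = 0
    · subst hi
      rw [← hεB0 b hb]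
      simp only [← TensorProduct.smul_tmul', map_smul]
      rw [hA _ (by omega) _ (SetLike.mul_mem_graded ha ha'), hA j (by omega) a ha, actA_tmul,
        hA k (by omega) a' ha', rTensor_tmul, mulLeft_apply]
    by_cases hj : j = 0
    · subst hj
      rw [← hεA0 a ha]
      simp only [TensorProduct.tmul_smul, ← TensorProduct.smul_tmul', map_smul, smul_mul_assoc,
        one_mul]
      rw [hB i (by omega) b hb, actA_tmul, mulLeft_one, rTensor_id, LinearMap.id_apply]
    by_cases hk : k = 0
    · subst hk
      rw [← hεA0 a' ha']
      simp only [TensorProduct.tmul_smul, map_smul, mul_smul_comm, mul_one]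
      rw [actA_one hB (by omega) (hg.apply_tmul_mem hb ha)]
    rw [← apply_delta1_eq_iff t' εA, delta1_congr εA hle (by omega) hb ha,
      Rmap1_congr hεA0 hεAp ht.1 hle (by omega) hijk hb ha ha',
      hpos _ (hijk' ▸ delta1_mem hεAp ht.1 hi hk hb ha ha'), hf1 _ (tmul_mem_kunneth
        (tmul_mem_kunneth ((mem_posF hi).2 hb) ((mem_posF hj).2 ha) rfl)
        ((mem_posF hk).2 ha') hijk')]
    exact kproj_eq_self 𝒜 ℬ (hijk' ▸ Rmap1_mem hεA0 hεAp ht.1 hb ha ha')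
  · rcases hijk.lt_or_eq with hlt | hijk'
    · rw [hne (i + j) k (by omega) _ (SetLike.mul_mem_graded hb hb') a ha,
        hne j k (by omega) b' hb' a ha, ht.apply_mul_left (by omega) hb hb' ha,
        actB_congr hle (fun p q hpq => Or.inl (by omega))
          (IsGradedMapBA.apply_tmul_mem ht.1 hb' ha) hb]
    by_cases hk : k = 0
    · subst hk
      rw [← hεA0 a ha]
      simp only [TensorProduct.tmul_smul, map_smul]
      rw [hB _ (by omega) _ (SetLike.mul_mem_graded hb hb'), hB j (by omega) b' hb', actB_tmul,
        hB i (by omega) b hb, lTensor_tmul, mulRight_apply]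
    by_cases hj : j = 0
    · subst hj
      rw [← hεB0 b' hb']
      simp only [TensorProduct.tmul_smul, ← TensorProduct.smul_tmul', map_smul, mul_smul_comm,
        mul_one]
      rw [hA k (by omega) a ha, actB_tmul, mulRight_one, lTensor_id, LinearMap.id_apply]
    by_cases hi : i = 0
    · subst hi
      rw [← hεB0 b hb]
      simp only [← TensorProduct.smul_tmul', map_smul, smul_mul_assoc, one_mul]
      rw [actB_one hA (by omega) (hg.apply_tmul_mem hb' ha)]
    have hijk'' : i + (j + k) = n + 1 := by omega
    rw [← apply_delta2_eq_iff t' εB, delta2_congr εB hle (by omega) hb' ha,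
      Rmap2_congr hεB0 hεBp ht.1 hle (by omega) hijk hb hb' ha,
      hpos _ (hijk'' ▸ delta2_mem hεBp ht.1 hi hk hb hb' ha), hf2 _ (tmul_mem_kunneth
        ((mem_posF hi).2 hb) (tmul_mem_kunneth ((mem_posF hj).2 hb') ((mem_posF hk).2 ha) rfl)
        hijk'')]
    exact kproj_eq_self 𝒜 ℬ (hijk'' ▸ Rmap2_mem hεB0 hεBp ht.1 hb hb' ha)

end Extension

/-- Lemma 3.1 (Twisting Map Extension Problem).  Let `t` be graded twisting to degree
`n`.  An extension of `t` which is graded twisting to degree `n+1` exists iff there is a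
linear map `f : (B₊ ⊗ A₊)_{n+1} → (A ⊗ B)_{n+1}` with `f ∘ δ_{n+1} = R_{n+1}`; and if an
extension exists, it is unique iff `δ_{n+1}` is surjective onto `(B₊ ⊗ A₊)_{n+1}`. -/
theorem stmt2 (𝒜 : ℕ → Submodule 𝕜 A) (ℬ : ℕ → Submodule 𝕜 B)
    [GradedAlgebra 𝒜] [GradedAlgebra ℬ]
    (hconnA : 𝒜 0 = (1 : Submodule 𝕜 A)) (hconnB : ℬ 0 = (1 : Submodule 𝕜 B))
    (εA : A →ₗ[𝕜] 𝕜) (hεA0 : ∀ x ∈ 𝒜 0, εA x • (1 : A) = x)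
    (hεAp : ∀ j, 0 < j → ∀ x ∈ 𝒜 j, εA x = 0)
    (εB : B →ₗ[𝕜] 𝕜) (hεB0 : ∀ x ∈ ℬ 0, εB x • (1 : B) = x)
    (hεBp : ∀ j, 0 < j → ∀ x ∈ ℬ j, εB x = 0)
    (n : ℕ) (t : B ⊗[𝕜] A →ₗ[𝕜] A ⊗[𝕜] B)
    (ht : TwistingToDeg 𝕜 A B 𝒜 ℬ t n) :
    ((∃ t' : B ⊗[𝕜] A →ₗ[𝕜] A ⊗[𝕜] B, ExtCond 𝕜 A B 𝒜 ℬ t t' n) ↔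
      (∃ f : B ⊗[𝕜] A →ₗ[𝕜] A ⊗[𝕜] B,
        (∀ x ∈ kunneth 𝕜 (kunneth 𝕜 (posF 𝕜 ℬ) (posF 𝕜 𝒜)) (posF 𝕜 𝒜) (n + 1),
          f (delta1 𝕜 A B εA t x) = Rmap1 𝕜 A B εA t x) ∧
        (∀ y ∈ kunneth 𝕜 (posF 𝕜 ℬ) (kunneth 𝕜 (posF 𝕜 ℬ) (posF 𝕜 𝒜)) (n + 1),
          f (delta2 𝕜 A B εB t y) = Rmap2 𝕜 A B εB t y))) ∧
    ((∃ t' : B ⊗[𝕜] A →ₗ[𝕜] A ⊗[𝕜] B, ExtCond 𝕜 A B 𝒜 ℬ t t' n) →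
      ((∀ t'₁ t'₂ : B ⊗[𝕜] A →ₗ[𝕜] A ⊗[𝕜] B,
          ExtCond 𝕜 A B 𝒜 ℬ t t'₁ n → ExtCond 𝕜 A B 𝒜 ℬ t t'₂ n →
          ∀ x ∈ kunneth 𝕜 ℬ 𝒜 (n + 1), t'₁ x = t'₂ x) ↔
        kunneth 𝕜 (posF 𝕜 ℬ) (posF 𝕜 𝒜) (n + 1) ≤
          Submodule.map (delta1 𝕜 A B εA t)
            (kunneth 𝕜 (kunneth 𝕜 (posF 𝕜 ℬ) (posF 𝕜 𝒜)) (posF 𝕜 𝒜) (n + 1)) ⊔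
          Submodule.map (delta2 𝕜 A B εB t)
            (kunneth 𝕜 (posF 𝕜 ℬ) (kunneth 𝕜 (posF 𝕜 ℬ) (posF 𝕜 𝒜)) (n + 1)))) := by
  refine ⟨⟨?_, ?_⟩, ?_⟩
  · rintro ⟨t', ht'⟩
    exact ⟨t', ht'.apply_delta1 hεA0 hεAp ht.1, ht'.apply_delta2 hεB0 hεBp ht.1⟩
  · rintro ⟨f, hf1, hf2⟩
    obtain ⟨t', ht', -⟩ := exists_extCond hεA0 hεAp hεB0 hεBp ht hf1 hf2
    exact ⟨t', ht'⟩
  rintro ⟨t', ht'⟩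
  have h1 := ht'.apply_delta1 hεA0 hεAp ht.1
  have h2 := ht'.apply_delta2 hεB0 hεBp ht.1
  constructor
  · intro huniq x₀ hx₀
    by_contra hx₀S
    obtain ⟨φ, hφ, hφS⟩ := Submodule.exists_le_ker_of_notMem hx₀S
    obtain ⟨w, hw, hw0⟩ : ∃ w ∈ kunneth 𝕜 𝒜 ℬ (n + 1), w ≠ 0 := by
      refine ⟨TensorProduct.comm 𝕜 B A x₀, ?_, ?_⟩
      · refine kunneth_le (S := Submodule.comap (TensorProduct.comm 𝕜 B A).toLinearMap
          (kunneth 𝕜 𝒜 ℬ (n + 1))) (fun i j hij b hb a ha => ?_) hx₀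
        exact tmul_mem_kunneth (posF_le 𝒜 _ ha) (posF_le ℬ _ hb) (by omega)
      · rw [Ne, LinearEquiv.map_eq_zero_iff]
        rintro rfl
        simp at hφ
    obtain ⟨t'', ht'', hval⟩ := exists_extCond hεA0 hεAp hεB0 hεBp ht
      (f := t' + φ.smulRight w)
      (fun x hx => by
        have : φ (delta1 𝕜 A B εA t x) = 0 :=
          hφS (Submodule.mem_sup_left (Submodule.mem_map_of_mem hx))
        simp [h1 x hx, this])
      (fun y hy => by
        have : φ (delta2 𝕜 A B εB t y) = 0 :=
          hφS (Submodule.mem_sup_right (Submodule.mem_map_of_mem hy))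
        simp [h2 y hy, this])
    have hx₀' := kunneth_mono (posF_le ℬ) (posF_le 𝒜) _ hx₀
    have hmem : t' x₀ ∈ kunneth 𝕜 𝒜 ℬ (n + 1) := ht'.1.1 _ (Submodule.mem_map_of_mem hx₀')
    have := huniq t'' t' ht'' ht' x₀ hx₀'
    rw [hval x₀ hx₀, LinearMap.add_apply, map_add, kproj_eq_self 𝒜 ℬ hmem,
      LinearMap.smulRight_apply, map_smul, kproj_eq_self 𝒜 ℬ hw, add_eq_left] at this
    exact (smul_ne_zero hφ hw0) this
  · intro hsurj t₁ t₂ ht₁ ht₂ x hx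
    have hpos : kunneth 𝕜 (posF 𝕜 ℬ) (posF 𝕜 𝒜) (n + 1) ≤ LinearMap.eqLocus t₁ t₂ := by
      refine hsurj.trans (sup_le ?_ ?_)
      · rintro _ ⟨y, hy, rfl⟩
        exact (ht₁.apply_delta1 hεA0 hεAp ht.1 y hy).trans
          (ht₂.apply_delta1 hεA0 hεAp ht.1 y hy).symm
      · rintro _ ⟨y, hy, rfl⟩
        exact (ht₁.apply_delta2 hεB0 hεBp ht.1 y hy).trans
          (ht₂.apply_delta2 hεB0 hεBp ht.1 y hy).symm
    refine kunneth_eqOn (fun i j hij b hb a ha => ?_) hx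
    by_cases hi : i = 0
    · subst hi
      rw [← hεB0 b hb]
      simp only [← TensorProduct.smul_tmul', map_smul]
      rw [ht₁.1.2.1 j (by omega) a ha, ht₂.1.2.1 j (by omega) a ha]
    by_cases hj : j = 0
    · subst hj
      rw [← hεA0 a ha]
      simp only [TensorProduct.tmul_smul, map_smul]
      rw [ht₁.1.2.2.1 i (by omega) b hb, ht₂.1.2.2.1 i (by omega) b hb]
    exact hpos (tmul_mem_kunneth ((mem_posF hi).2 hb) ((mem_posF hj).2 ha) hij)

end TTP
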